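/- Let A be an abelian group and let (g_k) be a sequence of elements of A with g_k ≠ 1 for all k. Then there exists a group homomorphism χ : A → S¹ into the circle group such that χ(g_k) does not converge to 1. -/

import Mathlib

open MeasureTheory Filter Topology

/-- The injective homomorphism `ℚ / ℤ → S¹`, `q ↦ exp (2πiq)`, written additively. -/
noncomputable def ratAddCircleToCircle : AddCircle (1 : ℚ) →+ Additive Circle :=
  QuotientAddGroup.lift _
    ((Circle.expHom.comp (AddMonoidHom.mulLeft (2 * Real.pi))).comp
      (Rat.castHom ℝ).toAddMonoidHom) (by
    intro x hx
    obtain ⟨n, rfl⟩ := AddSubgroup.mem_zmultiples_iff.1 hx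
    refine Circle.exp_eq_one.2 ⟨n, ?_⟩
    simp [mul_comm])

theorem eq_zero_of_ratAddCircleToCircle_eq_zero {x : AddCircle (1 : ℚ)}
    (hx : ratAddCircleToCircle x = 0) : x = 0 := by
  induction x using QuotientAddGroup.induction_on with
  | H q =>
    obtain ⟨n, hn⟩ := Circle.exp_eq_one.1
      (show Circle.exp (2 * Real.pi * (q : ℝ)) = 1 from hx)
    refine (AddCircle.coe_eq_zero_iff (1 : ℚ)).2 ⟨n, ?_⟩
    rw [mul_comm] at hn
    have h := mul_right_cancel₀ Real.two_pi_pos.ne' hn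
    rw [zsmul_one]
    exact_mod_cast h.symm

/-- Characters into the circle separate points of an abelian group. -/
theorem CommGroup.exists_monoidHom_circle_apply_ne_one {A : Type*} [CommGroup A] {a : A}
    (ha : a ≠ 1) : ∃ χ : A →* Circle, χ a ≠ 1 := by
  obtain ⟨c, hc⟩ := CharacterModule.exists_character_apply_ne_zero_of_ne_zero
    (A := Additive A) (a := Additive.ofMul a) ha
  exact ⟨AddMonoidHom.toMultiplicative (ratAddCircleToCircle.comp c), fun h => hc (eq_zero_of_ratAddCircleToCircle_eq_zero h)⟩

/-- The integral of a non-trivial character against a left-invariant measure vanishes. -/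
theorem integral_circle_monoidHom_eq_zero {K : Type*} [Group K] [MeasurableSpace K]
    [MeasurableMul K] (μ : Measure K) [μ.IsMulLeftInvariant] (f : K →* Circle)
    (hf : f ≠ 1) : ∫ x, (f x : ℂ) ∂μ = 0 := by
  obtain ⟨y, hy⟩ := DFunLike.ne_iff.1 hf
  have h := integral_mul_left_eq_self (μ := μ) (fun x => (f x : ℂ)) y
  simp only [map_mul, Circle.coe_mul, integral_const_mul] at h
  by_contra h0
  exact hy (Circle.ext ((mul_eq_right₀ h0).1 h))

/-- A sequence of non-trivial continuous characters of a compact group does not converge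
pointwise to the trivial character. -/
theorem not_tendsto_circle_monoidHom_one {K : Type*} [Group K] [TopologicalSpace K]
    [IsTopologicalGroup K] [CompactSpace K] (f : ℕ → K →* Circle)
    (hc : ∀ n, Continuous (f n)) (hf : ∀ n, f n ≠ 1) :
    ∃ x, ¬ Tendsto (fun n => f n x) atTop (𝓝 1) := by
  by_contra! h
  borelize K
  let μ : Measure K := Measure.haar
  have hlim : Tendsto (fun n => ∫ x, (f n x : ℂ) ∂μ) atTop (𝓝 (∫ _, (1 : ℂ) ∂μ)) := by
    refine tendsto_integral_of_dominated_convergence (fun _ => 1) (fun n => ?_)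
      (integrable_const 1) (fun n => ae_of_all _ fun x => (Circle.norm_coe _).le) (ae_of_all _ fun x => ?_)
    · exact (continuous_subtype_val.comp (hc n) : Continuous fun x => (f n x : ℂ)).aestronglyMeasurable
    · exact (Continuous.tendsto (f := fun z : Circle => (z : ℂ))
        continuous_subtype_val 1).comp (h x)
  simp only [fun n => integral_circle_monoidHom_eq_zero μ (f n) (hf n)] at hlim
  have h0 := tendsto_nhds_unique hlim tendsto_const_nhds
  simp [Measure.real, ENNReal.toReal_eq_zero_iff, NeZero.ne μ, measure_ne_top] at h0

/-- For any sequence of non-trivial elements of a discrete abelian group there is a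
character (homomorphism to the circle group) not sending the sequence to `1`. -/
theorem stmt_3 (A : Type) [CommGroup A] (g : ℕ → A) (hg : ∀ k, g k ≠ 1) :
    ∃ χ : A →* Circle, ¬ Filter.Tendsto (fun k => χ (g k)) Filter.atTop (nhds 1) := by
  let _ : TopologicalSpace A := ⊥
  have _ : DiscreteTopology A := ⟨rfl⟩
  let ev (a : A) : (A →ₜ* Circle) →* Circle :=
    { toFun := fun χ => χ a, map_one' := rfl, map_mul' := fun _ _ => rfl }
  obtain ⟨χ, hχ⟩ := not_tendsto_circle_monoidHom_one (fun k => ev (g k))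
    (fun k => continuous_eval_const (g k)) (fun k h => by
      obtain ⟨ψ, hψ⟩ := CommGroup.exists_monoidHom_circle_apply_ne_one (hg k)
      exact hψ (DFunLike.congr_fun h (⟨ψ, continuous_of_discreteTopology⟩ : A →ₜ* Circle)))
  exact ⟨χ.toMonoidHom, hχ⟩
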